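/- Let n be a nonempty finite type, 0 < α < 1, and A an n×n real matrix with complexification A_ℂ (the matrix with entries mapped into ℂ). Then E_α(t^α • A_ℂ) is invertible for every t > 0 if and only if for every eigenvalue λ ∈ spectrum ℂ A_ℂ and every ζ ∈ ℂ with E_α(ζ) = 0, the arguments satisfy arg(λ) ≠ arg(ζ). -/

import Mathlib

/-- The Mittag-Leffler function `E_α(z) = ∑ z^k / Γ(αk+1)`. -/
noncomputable def mlE (α : ℝ) (z : ℂ) : ℂ :=
  ∑' k : ℕ, ((Real.Gamma (α * k + 1) : ℂ))⁻¹ * z ^ k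

/-- The Mittag-Leffler matrix function `E_α(A) = ∑ A^k / Γ(αk+1)`. -/
noncomputable def mlMatC (α : ℝ) {n : Type*} [Fintype n] [DecidableEq n]
    (A : Matrix n n ℂ) : Matrix n n ℂ :=
  ∑' k : ℕ, (Real.Gamma (α * k + 1))⁻¹ • A ^ k

open Filter Topology in
theorem ml_gamma_lower (R x : ℝ) (hR : 0 < R) (hx : 0 ≤ x) :
    R ^ x * Real.exp (-R) ≤ Real.Gamma (x + 1) := by
  have hI := Real.GammaIntegral_convergent (s := x + 1) (by linarith)
  have hE : ∫ t in Set.Ioi R, Real.exp (-t) = Real.exp (-R) := integral_exp_neg_Ioi R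
  rw [Real.Gamma_eq_integral (by linarith)]
  calc R ^ x * Real.exp (-R) = ∫ t in Set.Ioi R, R ^ x * Real.exp (-t) := by
        rw [MeasureTheory.integral_const_mul, hE]
    _ ≤ ∫ t in Set.Ioi R, Real.exp (-t) * t ^ (x + 1 - 1) := by
        apply MeasureTheory.setIntegral_mono_on
        · exact (integrableOn_exp_neg_Ioi R).const_mul _
        · exact hI.mono_set (Set.Ioi_subset_Ioi hR.le)
        · exact measurableSet_Ioi
        · intro t ht
          rw [mul_comm, add_sub_cancel_right]
          have := Real.rpow_le_rpow hR.le (le_of_lt ht) hx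
          have := Real.exp_pos (-t)
          gcongr
    _ ≤ _ := by
        apply MeasureTheory.setIntegral_mono_set hI
        · filter_upwards [MeasureTheory.ae_restrict_mem measurableSet_Ioi] with t ht
          have : (0:ℝ) < t := ht
          positivity
        · exact (Set.Ioi_subset_Ioi hR.le).eventuallyLE

theorem ml_gamma_pos (α : ℝ) (hα : 0 < α) (k : ℕ) : 0 < Real.Gamma (α * k + 1) :=
  Real.Gamma_pos_of_pos (by positivity)

theorem ml_summable (α : ℝ) (hα : 0 < α) (r : ℝ) (hr : 0 ≤ r) :
    Summable fun k : ℕ => (Real.Gamma (α * k + 1))⁻¹ * r ^ k := by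
  set q := r + 1 with hq
  have hq0 : 0 < q := by linarith
  set R := q ^ (α⁻¹) with hRdef
  have hR : 0 < R := Real.rpow_pos_of_pos hq0 _
  have hg : Summable fun k : ℕ => Real.exp R * (r / q) ^ k :=
    (summable_geometric_of_lt_one (by positivity) (by rw [div_lt_one hq0]; linarith)).mul_left _
  refine Summable.of_nonneg_of_le (fun k => ?_) (fun k => ?_) hg
  · have := ml_gamma_pos α hα k
    positivity
  · have h := ml_gamma_lower R (α * k) hR (by positivity)
    have hpow : R ^ (α * k) = q ^ k := by
      rw [hRdef, ← Real.rpow_mul hq0.le, ← mul_assoc, inv_mul_cancel₀ hα.ne', one_mul,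
        Real.rpow_natCast]
    rw [hpow] at h
    have h2 : (Real.Gamma (α * k + 1))⁻¹ ≤ (q ^ k * Real.exp (-R))⁻¹ :=
      inv_anti₀ (by positivity) h
    calc _ ≤ (q ^ k * Real.exp (-R))⁻¹ * r ^ k := by gcongr
      _ = _ := by rw [Real.exp_neg, div_pow]; field_simp

theorem ml_hasSum (α : ℝ) (hα : 0 < α) (z : ℂ) :
    HasSum (fun k : ℕ => ((Real.Gamma (α * k + 1) : ℂ))⁻¹ * z ^ k) (mlE α z) := by
  refine Summable.hasSum (Summable.of_norm ?_)
  refine (ml_summable α hα ‖z‖ (norm_nonneg _)).congr fun k => ?_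
  have := ml_gamma_pos α hα k
  rw [norm_mul, norm_inv, norm_pow, Complex.norm_real, Real.norm_of_nonneg this.le]

section
attribute [local instance] Matrix.linftyOpNormedRing Matrix.linftyOpNormedAlgebra

theorem ml_mat_hasSum {n : Type*} [Fintype n] [DecidableEq n] [Nonempty n]
    (α : ℝ) (hα : 0 < α) (B : Matrix n n ℂ) :
    HasSum (fun k : ℕ => (Real.Gamma (α * k + 1))⁻¹ • B ^ k) (mlMatC α B) := by
  refine Summable.hasSum (Summable.of_norm ?_)
  have h1 : Summable fun k : ℕ => ‖(1 : Matrix n n ℂ)‖ *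
      ((Real.Gamma (α * k + 1))⁻¹ * ‖B‖ ^ k) :=
    (ml_summable α hα ‖B‖ (norm_nonneg _)).mul_left _
  refine Summable.of_nonneg_of_le (fun k => norm_nonneg _) (fun k => ?_) h1
  have hg := ml_gamma_pos α hα k
  have hp : ‖B ^ k‖ ≤ ‖(1 : Matrix n n ℂ)‖ * ‖B‖ ^ k := by
    induction k with
    | zero => simp
    | succ k ih =>
      rw [pow_succ, pow_succ, ← mul_assoc]
      exact (norm_mul_le _ _).trans (by gcongr; exact ih (ml_gamma_pos α hα k))
  rw [norm_smul, norm_inv, Real.norm_of_nonneg hg.le]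
  calc _ ≤ (Real.Gamma (α * k + 1))⁻¹ * (‖(1 : Matrix n n ℂ)‖ * ‖B‖ ^ k) := by gcongr
    _ = _ := by ring

end

theorem ml_commute {n : Type*} [Fintype n] [DecidableEq n] [Nonempty n]
    (α : ℝ) (hα : 0 < α) (B : Matrix n n ℂ) : Commute B (mlMatC α B) := by
  have h := ml_mat_hasSum α hα B
  have h1 := h.mul_left B
  have h2 := h.mul_right B
  refine h1.unique (h2.congr_fun ?_)
  intro k
  rw [mul_smul_comm, smul_mul_assoc, ← pow_succ, ← pow_succ']

theorem ml_mulVec {n : Type*} [Fintype n] [DecidableEq n] [Nonempty n]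
    (α : ℝ) (hα : 0 < α) (B : Matrix n n ℂ) (v : n → ℂ) (μ : ℂ)
    (hv : B.mulVec v = μ • v) : (mlMatC α B).mulVec v = mlE α μ • v := by
  have hpow : ∀ k : ℕ, (B ^ k).mulVec v = μ ^ k • v := by
    intro k
    induction k with
    | zero => simp
    | succ k ih =>
      rw [pow_succ, ← Matrix.mulVec_mulVec, hv, Matrix.mulVec_smul, ih, smul_smul, pow_succ,
        mul_comm]
  let φ : Matrix n n ℂ →+ (n → ℂ) :=
    { toFun := fun M => M.mulVec v
      map_zero' := Matrix.zero_mulVec v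
      map_add' := fun M N => Matrix.add_mulVec M N v }
  have hφ : Continuous φ := by
    change Continuous fun M : Matrix n n ℂ => M.mulVec v
    exact Continuous.matrix_mulVec continuous_id continuous_const
  have h1 := (ml_mat_hasSum α hα B).map φ hφ
  have h2 := (ml_hasSum α hα μ).smul_const v
  refine h1.unique (h2.congr_fun ?_)
  intro k
  change ((Real.Gamma (α * k + 1))⁻¹ • B ^ k).mulVec v = _
  rw [Matrix.smul_mulVec, hpow, mul_smul, ← Complex.ofReal_inv, Complex.coe_smul]

theorem ml_mem_spectrum {n : Type*} [Fintype n] [DecidableEq n]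
    (B : Matrix n n ℂ) (μ : ℂ) :
    μ ∈ spectrum ℂ B ↔ ∃ v : n → ℂ, v ≠ 0 ∧ B.mulVec v = μ • v := by
  rw [← Matrix.spectrum_toLin', ← Module.End.hasEigenvalue_iff_mem_spectrum]
  constructor
  · intro h
    obtain ⟨v, hv⟩ := h.exists_hasEigenvector
    exact ⟨v, hv.2, by simpa using hv.apply_eq_smul⟩
  · rintro ⟨v, hv, h⟩
    exact Module.End.hasEigenvalue_of_hasEigenvector
      (x := v) ⟨Module.End.mem_eigenspace_iff.2 (by simpa using h), hv⟩

theorem ml_exists {n : Type*} [Fintype n] [DecidableEq n] [Nonempty n]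
    (α : ℝ) (hα : 0 < α) (B : Matrix n n ℂ) (h : (mlMatC α B).det = 0) :
    ∃ (v : n → ℂ) (μ : ℂ), v ≠ 0 ∧ B.mulVec v = μ • v ∧ mlE α μ = 0 := by
  obtain ⟨w, hw, hw0⟩ := Matrix.exists_mulVec_eq_zero_iff.2 h
  let K := LinearMap.ker (Matrix.toLin' (mlMatC α B))
  have hK : ∀ x ∈ K, Matrix.toLin' B x ∈ K := by
    intro x hx
    have hx' : (mlMatC α B).mulVec x = 0 := by simpa [K] using hx
    have : (mlMatC α B).mulVec (B.mulVec x) = 0 := by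
      rw [Matrix.mulVec_mulVec, ← (ml_commute α hα B).eq, ← Matrix.mulVec_mulVec, hx',
        Matrix.mulVec_zero]
    simpa [K] using this
  have hwK : w ∈ K := by simpa [K] using hw0
  have : Nontrivial K := ⟨⟨⟨w, hwK⟩, 0, fun h => hw (congrArg Subtype.val h)⟩⟩
  obtain ⟨μ, hμ⟩ := Module.End.exists_eigenvalue ((Matrix.toLin' B).restrict hK)
  obtain ⟨v, hv⟩ := hμ.exists_hasEigenvector
  have hv0 : (v : n → ℂ) ≠ 0 := fun h => hv.2 (Subtype.ext h)
  have hBv : B.mulVec (v : n → ℂ) = μ • (v : n → ℂ) := by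
    simpa using congrArg Subtype.val hv.apply_eq_smul
  refine ⟨v, μ, hv0, hBv, ?_⟩
  have h1 := ml_mulVec α hα B v μ hBv
  have h2 : (mlMatC α B).mulVec (v : n → ℂ) = 0 :=
    LinearMap.mem_ker.1 v.2
  rw [h2] at h1
  exact (smul_eq_zero.1 h1.symm).resolve_right hv0

theorem ml_pos (α : ℝ) (hα : 0 < α) (r : ℝ) (hr : 0 ≤ r) : mlE α r ≠ 0 := by
  have hs := ml_summable α hα r hr
  have h1 : 0 < ∑' k : ℕ, (Real.Gamma (α * k + 1))⁻¹ * r ^ k := by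
    refine hs.tsum_pos (fun k => ?_) 0 ?_
    · have := ml_gamma_pos α hα k
      positivity
    · simp
  have h2 : mlE α r = ((∑' k : ℕ, (Real.Gamma (α * k + 1))⁻¹ * r ^ k : ℝ) : ℂ) := by
    rw [mlE, Complex.ofReal_tsum]
    push_cast
    rfl
  rw [h2]
  exact_mod_cast h1.ne'

theorem mittagLeffler_invertible_all_times_iff_arg {n : Type*} [Fintype n] [DecidableEq n]
    [Nonempty n] (α : ℝ) (hα0 : 0 < α) (hα1 : α < 1) (A : Matrix n n ℝ) :
    (∀ t : ℝ, 0 < t → (mlMatC α ((t ^ α) • A.map Complex.ofReal)).det ≠ 0) ↔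
      ∀ lam ∈ spectrum ℂ (A.map Complex.ofReal), ∀ ζ : ℂ, mlE α ζ = 0 →
        lam.arg ≠ ζ.arg := by
  constructor
  · intro H lam hlam ζ hζ harg
    obtain ⟨v, hv0, hv⟩ := (ml_mem_spectrum _ _).1 hlam
    have hnn : ¬ (ζ.arg = 0) := by
      intro h0
      obtain ⟨hre, him⟩ := Complex.arg_eq_zero_iff.1 h0
      have : ζ = (ζ.re : ℂ) := Complex.ext rfl (by simpa using him)
      rw [this] at hζ
      exact ml_pos α hα0 _ hre hζ
    have hζ0 : ζ ≠ 0 := by rintro rfl; simp at hnn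
    have hl0 : lam ≠ 0 := by rintro rfl; simp at harg; exact hnn harg.symm
    have hc : 0 < ‖ζ‖ / ‖lam‖ := div_pos (norm_pos_iff.2 hζ0) (norm_pos_iff.2 hl0)
    have heq := (Complex.arg_eq_arg_iff hl0 hζ0).1 harg
    refine H ((‖ζ‖ / ‖lam‖) ^ α⁻¹) (Real.rpow_pos_of_pos hc _) ?_
    rw [← Real.rpow_mul hc.le, inv_mul_cancel₀ hα0.ne', Real.rpow_one]
    refine Matrix.exists_mulVec_eq_zero_iff.1 ⟨v, hv0, ?_⟩
    rw [ml_mulVec α hα0 _ v ζ, hζ, zero_smul]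
    have hz : ζ • v = ((‖ζ‖ : ℂ) / ‖lam‖ * lam) • v := by rw [heq]
    rw [Matrix.smul_mulVec, hv, hz, mul_smul, ← Complex.ofReal_div, Complex.coe_smul]
  · intro H t ht hdet
    obtain ⟨v, μ, hv0, hv, hμ⟩ := ml_exists α hα0 _ hdet
    have hc : 0 < t ^ α := Real.rpow_pos_of_pos ht _
    refine H (((t ^ α)⁻¹ : ℝ) * μ) ((ml_mem_spectrum _ _).2 ⟨v, hv0, ?_⟩) μ hμ
      (Complex.arg_real_mul _ (inv_pos.2 hc))
    rw [mul_smul, ← hv, Matrix.smul_mulVec, Complex.coe_smul, smul_smul,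
      inv_mul_cancel₀ hc.ne', one_smul]
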